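/- arXiv:2003.05175 — 7 statements merged into one kernel-verified Lean document; each statement's English description precedes it below -/
import Mathlib

section
/- Let G be a finite simple graph (not necessarily bipartite), let M be a matching in G, let P be an augmenting path in G with respect to M, and let Q be an augmenting path in G with respect to M△P. Then there exist two augmenting paths X and Y in G with respect to M such that (1) X and Y are edge-disjoint; (2) every edge of X and of Y is an edge of P or of Q (i.e., X ∪ Y ⊆ P ∪ Q as edge sets); and (3) the set of the four endpoints of X and Y equals the set of the four endpoints of P and Q. -/
open scoped Classical symmDiff

/-- `M` is a matching in the simple graph `G`: a set of edges of `G`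
no two of which share an endpoint. -/
def IsMatching {V : Type*} (G : SimpleGraph V) (M : Finset (Sym2 V)) : Prop :=
  (M : Set (Sym2 V)) ⊆ G.edgeSet ∧
    ∀ e ∈ M, ∀ f ∈ M, e ≠ f → ∀ v : V, v ∈ e → v ∉ f

/-- A vertex is matched by `M` if it is an endpoint of some edge of `M`. -/
def Matched {V : Type*} (M : Finset (Sym2 V)) (v : V) : Prop :=
  ∃ e ∈ M, v ∈ e

/-- A list of edges alternates with respect to the matching `M`. -/
def Alternating {V : Type*} (M : Finset (Sym2 V)) (l : List (Sym2 V)) : Prop :=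
  ∀ (i : ℕ) (h : i + 1 < l.length), ((l[i]'(by omega)) ∈ M ↔ (l[i + 1]'h) ∉ M)

/-- `p` is an augmenting path in `G` with respect to the matching `M`:
a path with at least one edge, both of whose endpoints are exposed, and whose
edges alternate between edges not in `M` and edges in `M`. -/
structure IsAugPath {V : Type*} (G : SimpleGraph V) (M : Finset (Sym2 V))
    {a b : V} (p : G.Walk a b) : Prop where
  isPath : p.IsPath
  pos : 0 < p.length
  expA : ¬ Matched M a
  expB : ¬ Matched M b
  alt : Alternating M p.edges


theorem IsMatching.eq_of_mem {V : Type*} {G : SimpleGraph V} {M : Finset (Sym2 V)}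
    (hM : IsMatching G M) {e f : Sym2 V} {v : V} (he : e ∈ M) (hf : f ∈ M)
    (hve : v ∈ e) (hvf : v ∈ f) : e = f := by
  by_contra h
  exact hM.2 e he f hf h v hve hvf

theorem SimpleGraph.Walk.mk_getVert_mem_edges {V : Type*} {G : SimpleGraph V} {a b : V}
    (p : G.Walk a b) {i : ℕ} (hi : i < p.length) :
    s(p.getVert i, p.getVert (i + 1)) ∈ p.edges :=
  p.mk_mem_edges_iff_exists.2 ⟨i, hi, rfl⟩

theorem SimpleGraph.Walk.mem_support_of_mem_of_mem_edges {V : Type*} {G : SimpleGraph V} {a b : V}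
    (p : G.Walk a b) {e : Sym2 V} {v : V} (he : e ∈ p.edges) (hv : v ∈ e) : v ∈ p.support := by
  induction e with
  | _ x y =>
    rcases Sym2.mem_iff.1 hv with rfl | rfl
    · exact p.fst_mem_support_of_mem_edges he
    · exact p.snd_mem_support_of_mem_edges he

theorem SimpleGraph.Walk.IsPath.edge_eq_of_getVert_mem {V : Type*} {G : SimpleGraph V} {a b : V}
    {p : G.Walk a b} (hp : p.IsPath) {e : Sym2 V} (he : e ∈ p.edges) {i : ℕ} (hi : i ≤ p.length)
    (hv : p.getVert i ∈ e) :
    (i < p.length ∧ e = s(p.getVert i, p.getVert (i + 1))) ∨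
      ∃ j, j + 1 = i ∧ e = s(p.getVert j, p.getVert (j + 1)) := by
  induction e with
  | _ x y =>
    obtain ⟨k, hk, hke⟩ := p.mk_mem_edges_iff_exists.1 he
    rw [← hke] at hv ⊢
    rcases Sym2.mem_iff.1 hv with h | h
    · obtain rfl : i = k := hp.getVert_injOn hi hk.le h
      exact .inl ⟨hk, rfl⟩
    · obtain rfl : i = k + 1 := hp.getVert_injOn hi hk h
      exact .inr ⟨k, rfl, rfl⟩

theorem alternating_edges_iff {V : Type*} {G : SimpleGraph V} {M : Finset (Sym2 V)} {a b : V}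
    (p : G.Walk a b) :
    Alternating M p.edges ↔ ∀ i, i + 1 < p.length →
      (s(p.getVert i, p.getVert (i + 1)) ∈ M ↔ s(p.getVert (i + 1), p.getVert (i + 2)) ∉ M) := by
  simp only [Alternating, SimpleGraph.Walk.getElem_edges, SimpleGraph.Walk.length_edges]

theorem Alternating.mem_iff_notMem {V : Type*} {G : SimpleGraph V} {M : Finset (Sym2 V)} {a b : V}
    {p : G.Walk a b} (hp : p.IsPath) (halt : Alternating M p.edges) {e f : Sym2 V} {v : V}
    (he : e ∈ p.edges) (hf : f ∈ p.edges) (hve : v ∈ e) (hvf : v ∈ f) (hne : e ≠ f) :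
    e ∈ M ↔ f ∉ M := by
  obtain ⟨i, rfl, hi⟩ := SimpleGraph.Walk.mem_support_iff_exists_getVert.1
    (p.mem_support_of_mem_of_mem_edges he hve)
  rw [alternating_edges_iff] at halt
  rcases hp.edge_eq_of_getVert_mem he hi hve with ⟨h1, h2⟩ | ⟨j, h1, h2⟩ <;>
    rcases hp.edge_eq_of_getVert_mem hf hi hvf with ⟨h3, h4⟩ | ⟨k, h3, h4⟩
  · exact absurd (h2.trans h4.symm) hne
  · subst h3 h2 h4
    have := halt k h1
    tauto
  · subst h1 h2 h4
    exact halt j h3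
  · obtain rfl : j = k := by omega
    exact absurd (h2.trans h4.symm) hne

theorem Alternating.exists_mem_and_notMem {V : Type*} {G : SimpleGraph V} {M : Finset (Sym2 V)}
    {a b : V} {p : G.Walk a b} (halt : Alternating M p.edges) {v : V}
    (hv : v ∈ p.support) (ha : v ≠ a) (hb : v ≠ b) :
    (∃ e ∈ p.edges, e ∈ M ∧ v ∈ e) ∧ ∃ e ∈ p.edges, e ∉ M ∧ v ∈ e := by
  obtain ⟨i, rfl, hi⟩ := SimpleGraph.Walk.mem_support_iff_exists_getVert.1 hv
  obtain _ | i := i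
  · simp at ha
  have hi' : i + 1 < p.length := by
    refine lt_of_le_of_ne hi fun h => hb ?_
    rw [h, p.getVert_length]
  have h1 := p.mk_getVert_mem_edges (i := i) (by omega)
  have h2 := p.mk_getVert_mem_edges (i := i + 1) hi'
  have h3 := (alternating_edges_iff p).1 halt i hi'
  by_cases h : s(p.getVert i, p.getVert (i + 1)) ∈ M
  · exact ⟨⟨_, h1, h, by simp⟩, ⟨_, h2, h3.1 h, by simp⟩⟩
  · exact ⟨⟨_, h2, by tauto, by simp⟩, ⟨_, h1, h, by simp⟩⟩

theorem IsAugPath.exists_notMem {V : Type*} {G : SimpleGraph V} {M : Finset (Sym2 V)}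
    {a b : V} {p : G.Walk a b} (hp : IsAugPath G M p) {v : V} (hv : v ∈ p.support) :
    ∃ e ∈ p.edges, e ∉ M ∧ v ∈ e := by
  have hpos := hp.pos
  by_cases ha : v = a
  · subst ha
    have h := p.mk_getVert_mem_edges hpos
    rw [p.getVert_zero] at h
    exact ⟨_, h, fun h' => hp.expA ⟨_, h', by simp⟩, by simp⟩
  by_cases hb : v = b
  · subst hb
    have h := p.mk_getVert_mem_edges (i := p.length - 1) (by omega)
    rw [Nat.sub_add_cancel hpos, p.getVert_length] at h
    exact ⟨_, h, fun h' => hp.expB ⟨_, h', by simp⟩, by simp⟩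
  exact (hp.alt.exists_mem_and_notMem hv ha hb).2

theorem IsAugPath.ne {V : Type*} {G : SimpleGraph V} {M : Finset (Sym2 V)}
    {a b : V} {p : G.Walk a b} (hp : IsAugPath G M p) : a ≠ b := by
  rintro rfl
  exact hp.pos.ne' (SimpleGraph.Walk.length_eq_zero_iff.2
    (SimpleGraph.Walk.isPath_iff_nil.1 hp.isPath))

/-- Augmenting a matching along an augmenting path yields a matching. -/
theorem IsMatching.augment {V : Type*} {G : SimpleGraph V} {M N : Finset (Sym2 V)} {a b : V}
    {p : G.Walk a b} (hM : IsMatching G M) (hp : IsAugPath G M p)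
    (hN : ∀ e, e ∈ N ↔ (e ∈ M ↔ e ∉ p.edges)) : IsMatching G N := by
  have key : ∀ e ∈ M, e ∉ p.edges → ∀ f ∈ p.edges, ∀ v, v ∈ e → v ∉ f := by
    intro e he hep f hf v hve hvf
    by_cases ha : v = a
    · exact hp.expA ⟨e, he, ha ▸ hve⟩
    by_cases hb : v = b
    · exact hp.expB ⟨e, he, hb ▸ hve⟩
    obtain ⟨g, hg, hgM, hvg⟩ := (hp.alt.exists_mem_and_notMem
      (p.mem_support_of_mem_of_mem_edges hf hvf) ha hb).1
    exact hep (hM.eq_of_mem he hgM hve hvg ▸ hg)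
  refine ⟨fun e he => ?_, fun e he f hf hne v hve hvf => ?_⟩
  · by_cases h : e ∈ p.edges
    · exact p.edges_subset_edgeSet h
    · exact hM.1 (((hN e).1 he).2 h)
  · rw [hN] at he hf
    by_cases hep : e ∈ p.edges <;> by_cases hfp : f ∈ p.edges
    · have := hp.alt.mem_iff_notMem hp.isPath hep hfp hve hvf hne
      tauto
    · exact key f (hf.2 hfp) hfp e hep v hvf hve
    · exact key e (he.2 hep) hep f hfp v hve hvf
    · exact hne (hM.eq_of_mem (he.2 hep) (hf.2 hfp) hve hvf)

theorem IsAugPath.matched_augment_iff {V : Type*} {G : SimpleGraph V} {M N : Finset (Sym2 V)}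
    {a b : V} {p : G.Walk a b} (hp : IsAugPath G M p)
    (hN : ∀ e, e ∈ N ↔ (e ∈ M ↔ e ∉ p.edges)) (v : V) :
    Matched N v ↔ Matched M v ∨ v = a ∨ v = b := by
  have key : v ∈ p.support → Matched N v := fun hv => by
    obtain ⟨e, hep, heM, hve⟩ := hp.exists_notMem hv
    exact ⟨e, (hN e).2 (by tauto), hve⟩
  constructor
  · rintro ⟨e, he, hve⟩
    by_cases heM : e ∈ M
    · exact .inl ⟨e, heM, hve⟩
    have hep : e ∈ p.edges := by
      have := (hN e).1 he
      tauto
    by_cases ha : v = a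
    · exact .inr (.inl ha)
    by_cases hb : v = b
    · exact .inr (.inr hb)
    obtain ⟨g, -, hgM, hvg⟩ := (hp.alt.exists_mem_and_notMem
      (p.mem_support_of_mem_of_mem_edges hep hve) ha hb).1
    exact .inl ⟨g, hgM, hvg⟩
  · rintro (⟨e, he, hve⟩ | rfl | rfl)
    · by_cases hep : e ∈ p.edges
      · exact key (p.mem_support_of_mem_of_mem_edges hep hve)
      · exact ⟨e, (hN e).2 (by tauto), hve⟩
    · exact key p.start_mem_support
    · exact key p.end_mem_support

/-- A path in the symmetric difference of two matchings alternates between them. -/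
theorem alternating_of_forall_mem_symmDiff {V : Type*} {G : SimpleGraph V}
    {M N : Finset (Sym2 V)} (hM : IsMatching G M) (hN : IsMatching G N) {a b : V} {p : G.Walk a b}
    (hp : p.IsPath) (hD : ∀ e ∈ p.edges, ¬(e ∈ M ↔ e ∈ N)) : Alternating M p.edges := by
  rw [alternating_edges_iff]
  intro i hi
  have h1 := hD _ (p.mk_getVert_mem_edges (i := i) (by omega))
  have h2 := hD _ (p.mk_getVert_mem_edges (i := i + 1) hi)
  have hne : s(p.getVert i, p.getVert (i + 1)) ≠ s(p.getVert (i + 1), p.getVert (i + 2)) := by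
    intro h
    rcases Sym2.eq_iff.1 h with ⟨h, -⟩ | ⟨h, -⟩
    · have := hp.getVert_injOn (show i ≤ p.length by omega) (show i + 1 ≤ p.length by omega) h
      omega
    · have := hp.getVert_injOn (show i ≤ p.length by omega) (show i + 2 ≤ p.length by omega) h
      omega
  constructor
  · exact fun h h' => hne (hM.eq_of_mem h h' (v := p.getVert (i + 1)) (by simp) (by simp))
  · intro h
    by_contra h'
    exact hne (hN.eq_of_mem (v := p.getVert (i + 1)) (by tauto) (by tauto) (by simp) (by simp))

/-- A vertex exposed by `M` but matched by `N` starts a path forming a whole connected component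
of the symmetric difference of the matchings `M` and `N`. -/
theorem exists_component_path {V : Type*} [Finite V] {G : SimpleGraph V}
    {M N : Finset (Sym2 V)} (hM : IsMatching G M) (hN : IsMatching G N) {v : V}
    (hvM : ¬ Matched M v) (hvN : Matched N v) :
    ∃ (w : V) (p : G.Walk v w), p.IsPath ∧ 0 < p.length ∧ (∀ e ∈ p.edges, ¬(e ∈ M ↔ e ∈ N)) ∧
      ¬(Matched M w ↔ Matched N w) ∧
      ∀ e, ¬(e ∈ M ↔ e ∈ N) → ∀ u ∈ p.support, u ∈ e → e ∈ p.edges := by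
  have := Fintype.ofFinite V
  let S : Set ℕ := {n | ∃ (w : V) (p : G.Walk v w), p.IsPath ∧
    (∀ e ∈ p.edges, ¬(e ∈ M ↔ e ∈ N)) ∧ p.length = n}
  have hfin : S.Finite := (Set.finite_Iio (Fintype.card V)).subset (by
    rintro n ⟨w, p, hp, -, rfl⟩
    exact hp.length_lt)
  obtain ⟨n, ⟨w, p, hp, hD, rfl⟩, hmax⟩ := hfin.exists_maximal ⟨0, v, .nil, by simp⟩
  replace hmax : ∀ n ∈ S, n ≤ p.length := fun n hn => by
    by_contra h
    exact h (hmax hn (by omega))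
  have hext : ∀ x, (hx : G.Adj w x) → ¬(s(w, x) ∈ M ↔ s(w, x) ∈ N) → x ∈ p.support := by
    intro x hx hxD
    by_contra h
    have := hmax (p.length + 1) ⟨x, p.concat hx, hp.concat h hx, by
      simp only [SimpleGraph.Walk.edges_concat, List.concat_eq_append, List.mem_append,
        List.mem_singleton]
      rintro e (he | rfl)
      exacts [hD e he, hxD], by simp⟩
    omega
  have hadj : ∀ e, ¬(e ∈ M ↔ e ∈ N) → e ∈ G.edgeSet := fun e he => by
    by_cases h : e ∈ M
    · exact hM.1 h
    · exact hN.1 (show e ∈ N by tauto)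
  have hpos : 0 < p.length := by
    by_contra h0
    obtain rfl : v = w := p.eq_of_length_eq_zero (by omega)
    obtain rfl := (SimpleGraph.Walk.eq_nil_iff_nil.2 (SimpleGraph.Walk.isPath_iff_nil.1 hp))
    obtain ⟨e, he, hve⟩ := hvN
    obtain ⟨x, rfl⟩ := hve
    have hx := hadj _ (fun h => hvM ⟨_, h.2 he, by simp⟩)
    have := hext x hx (fun h => hvM ⟨_, h.2 he, by simp⟩)
    simp only [SimpleGraph.Walk.support_nil, List.mem_singleton] at this
    exact G.ne_of_adj hx this.symm
  have halt := alternating_of_forall_mem_symmDiff hM hN hp hD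
  have hclosed : ∀ e, ¬(e ∈ M ↔ e ∈ N) → ∀ u ∈ p.support, u ≠ w → u ∈ e → e ∈ p.edges := by
    intro e he u hu huw hue
    by_cases huv : u = v
    · subst huv
      have h := p.mk_getVert_mem_edges hpos
      rw [p.getVert_zero] at h
      have h1 := hD _ h
      have h2 : s(u, p.getVert (0 + 1)) ∉ M := fun h' => hvM ⟨_, h', by simp⟩
      have h3 : e ∉ M := fun h' => hvM ⟨_, h', hue⟩
      have h4 : s(u, p.getVert (0 + 1)) ∈ N := by tauto
      rwa [hN.eq_of_mem (show e ∈ N by tauto) h4 hue (Sym2.mem_mk_left _ _)]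
    obtain ⟨⟨f, hf, hfM, huf⟩, ⟨g, hg, hgM, hug⟩⟩ := halt.exists_mem_and_notMem hu huv huw
    by_cases heM : e ∈ M
    · rwa [hM.eq_of_mem heM hfM hue huf]
    · have := hD g hg
      rwa [hN.eq_of_mem (show e ∈ N by tauto) (show g ∈ N by tauto) hue hug]
  have hclosed' : ∀ e, ¬(e ∈ M ↔ e ∈ N) → ∀ u ∈ p.support, u ∈ e → e ∈ p.edges := by
    intro e he u hu hue
    by_cases huw : u = w
    · subst huw
      obtain ⟨x, rfl⟩ := hue
      have hx := hadj _ he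
      exact hclosed _ he x (hext x hx he) (G.ne_of_adj hx).symm (by simp)
    · exact hclosed e he u hu huw hue
  refine ⟨w, p, hp, hpos, hD, ?_, hclosed'⟩
  obtain ⟨e, he, hwe, huniq⟩ : ∃ e ∈ p.edges, w ∈ e ∧ ∀ f ∈ p.edges, w ∈ f → f = e := by
    have h := p.mk_getVert_mem_edges (i := p.length - 1) (by omega)
    refine ⟨_, h, by simp [Nat.sub_add_cancel hpos], fun f hf hwf => ?_⟩
    rcases hp.edge_eq_of_getVert_mem hf le_rfl (by simpa using hwf) with ⟨h, -⟩ | ⟨j, hj, rfl⟩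
    · omega
    · rw [← hj, Nat.add_sub_cancel]
  have heD := hD e he
  intro hiff
  by_cases heM : e ∈ M
  · obtain ⟨f, hf, hwf⟩ := hiff.1 ⟨e, heM, hwe⟩
    by_cases hfM : f ∈ M
    · obtain rfl := hM.eq_of_mem heM hfM hwe hwf
      tauto
    · obtain rfl := huniq f (hclosed' f (by tauto) w p.end_mem_support hwf) hwf
      tauto
  · have heN : e ∈ N := by tauto
    obtain ⟨f, hf, hwf⟩ := hiff.2 ⟨e, heN, hwe⟩
    by_cases hfN : f ∈ N
    · obtain rfl := hN.eq_of_mem heN hfN hwe hwf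
      tauto
    · obtain rfl := huniq f (hclosed' f (by tauto) w p.end_mem_support hwf) hwf
      tauto

theorem card_four {V : Type*} [DecidableEq V] {a b c d : V} (hab : a ≠ b) (hac : a ≠ c)
    (had : a ≠ d) (hbc : b ≠ c) (hbd : b ≠ d) (hcd : c ≠ d) :
    ({a, b, c, d} : Finset V).card = 4 := by
  simp [Finset.card_insert_of_notMem, *]

/-- Surgery lemma: if `P` is an augmenting path with respect to the matching `M`
and `Q` is an augmenting path with respect to `M △ P`, then there exist two
augmenting paths `X`, `Y` with respect to `M` that are edge-disjoint, whose edges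
all come from `P` or `Q`, and whose four endpoints are exactly the four endpoints
of `P` and `Q`. -/
theorem stmt1 {V : Type*} [Fintype V] [DecidableEq V] (G : SimpleGraph V)
    (M : Finset (Sym2 V)) (hM : IsMatching G M)
    {a b : V} (P : G.Walk a b) (hP : IsAugPath G M P)
    {c d : V} (Q : G.Walk c d) (hQ : IsAugPath G (M ∆ P.edges.toFinset) Q) :
    ∃ (x₁ x₂ y₁ y₂ : V) (X : G.Walk x₁ x₂) (Y : G.Walk y₁ y₂),
      IsAugPath G M X ∧ IsAugPath G M Y ∧
      Disjoint X.edges.toFinset Y.edges.toFinset ∧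
      X.edges.toFinset ∪ Y.edges.toFinset ⊆ P.edges.toFinset ∪ Q.edges.toFinset ∧
      ({x₁, x₂, y₁, y₂} : Finset V) = ({a, b, c, d} : Finset V) := by
  set M₁ := M ∆ P.edges.toFinset with hM₁
  set N := M₁ ∆ Q.edges.toFinset with hN
  have hmem₁ : ∀ e, e ∈ M₁ ↔ (e ∈ M ↔ e ∉ P.edges) := fun e => by
    rw [hM₁, Finset.mem_symmDiff, List.mem_toFinset]
    tauto
  have hmem : ∀ e, e ∈ N ↔ (e ∈ M₁ ↔ e ∉ Q.edges) := fun e => by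
    rw [hN, Finset.mem_symmDiff, List.mem_toFinset]
    tauto
  have hMatch₁ : IsMatching G M₁ := hM.augment hP hmem₁
  have hMatch : IsMatching G N := hMatch₁.augment hQ hmem
  have hmatched : ∀ v, Matched N v ↔ Matched M v ∨ v ∈ ({a, b, c, d} : Finset V) := fun v => by
    rw [hQ.matched_augment_iff hmem, hP.matched_augment_iff hmem₁]
    simp only [Finset.mem_insert, Finset.mem_singleton]
    tauto
  have hexp : ∀ v ∈ ({a, b, c, d} : Finset V), ¬ Matched M v := by
    have hc := hQ.expA
    have hd := hQ.expB
    rw [hP.matched_augment_iff hmem₁] at hc hd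
    simp only [Finset.mem_insert, Finset.mem_singleton]
    rintro v (rfl | rfl | rfl | rfl)
    exacts [hP.expA, hP.expB, fun h => hc (.inl h), fun h => hd (.inl h)]
  have hcard : ({a, b, c, d} : Finset V).card = 4 := by
    have hc := hQ.expA
    have hd := hQ.expB
    rw [hP.matched_augment_iff hmem₁] at hc hd
    push Not at hc hd
    have h1 := hP.ne
    have h2 := hQ.ne
    exact card_four h1 hc.2.1.symm hd.2.1.symm hc.2.2.symm hd.2.2.symm h2
  have hsub : ∀ e, ¬(e ∈ M ↔ e ∈ N) → e ∈ P.edges ∨ e ∈ Q.edges := fun e he => by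
    rw [hmem, hmem₁] at he
    tauto
  have hend : ∀ v, ¬(Matched M v ↔ Matched N v) → v ∈ ({a, b, c, d} : Finset V) := fun v hv => by
    rw [hmatched] at hv
    tauto
  have haug : ∀ {v w : V} (p : G.Walk v w), v ∈ ({a, b, c, d} : Finset V) →
      w ∈ ({a, b, c, d} : Finset V) → p.IsPath → 0 < p.length →
      (∀ e ∈ p.edges, ¬(e ∈ M ↔ e ∈ N)) → IsAugPath G M p := fun p hv hw hp hpos hD =>
    ⟨hp, hpos, hexp _ hv, hexp _ hw, alternating_of_forall_mem_symmDiff hM hMatch hp hD⟩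
  have hpath : ∀ v ∈ ({a, b, c, d} : Finset V), ∃ w ∈ ({a, b, c, d} : Finset V),
      ∃ p : G.Walk v w, IsAugPath G M p ∧ (∀ e ∈ p.edges, ¬(e ∈ M ↔ e ∈ N)) ∧
        ∀ e, ¬(e ∈ M ↔ e ∈ N) → ∀ u ∈ p.support, u ∈ e → e ∈ p.edges := fun v hv => by
    obtain ⟨w, p, hp, hpos, hD, hw, hcl⟩ :=
      exists_component_path hM hMatch (hexp v hv) ((hmatched v).2 (.inr hv))
    exact ⟨w, hend w hw, p, haug p hv (hend w hw) hp hpos hD, hD, hcl⟩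
  have ha : a ∈ ({a, b, c, d} : Finset V) := by simp
  obtain ⟨w, hw, X, hX, hXD, hXcl⟩ := hpath a ha
  obtain ⟨y, hy, hyaw⟩ : ∃ y ∈ ({a, b, c, d} : Finset V), y ∉ ({a, w} : Finset V) :=
    Finset.exists_mem_notMem_of_card_lt_card (by
      rw [hcard]
      exact Finset.card_le_two.trans_lt (by norm_num))
  simp only [Finset.mem_insert, Finset.mem_singleton, not_or] at hyaw
  obtain ⟨z, hz, Y, hY, hYD, hYcl⟩ := hpath y hy
  have hyX : y ∉ X.support := fun h => by
    obtain ⟨e, -, he, hye⟩ := (hX.alt.exists_mem_and_notMem h hyaw.1 hyaw.2).1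
    exact hexp y hy ⟨e, he, hye⟩
  have hYX : ∀ i ≤ Y.length, Y.getVert i ∉ X.support := by
    intro i
    induction i with
    | zero => simpa using hyX
    | succ i ih =>
      intro hi h
      have he := hXcl _ (hYD _ (Y.mk_getVert_mem_edges hi)) _ h (by simp)
      exact ih (by omega) (X.mem_support_of_mem_of_mem_edges he (by simp))
  have hzX : z ∉ X.support := by simpa using hYX Y.length le_rfl
  have hza : z ≠ a := fun h => hzX (h ▸ X.start_mem_support)
  have hzw : z ≠ w := fun h => hzX (h ▸ X.end_mem_support)
  refine ⟨a, w, y, z, X, Y, hX, hY, ?_, ?_, ?_⟩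
  · rw [Finset.disjoint_left]
    intro e heX heY
    rw [List.mem_toFinset] at heX heY
    induction e with
    | _ s t =>
      obtain ⟨i, hi, hil⟩ := SimpleGraph.Walk.mem_support_iff_exists_getVert.1
        (Y.fst_mem_support_of_mem_edges heY)
      exact hYX i hil (hi ▸ X.fst_mem_support_of_mem_edges heX)
  · intro e he
    simp only [Finset.mem_union, List.mem_toFinset] at he ⊢
    exact hsub e (he.elim (hXD e) (hYD e))
  · refine Finset.eq_of_subset_of_card_le ?_ ?_
    · simp only [Finset.insert_subset_iff, Finset.singleton_subset_iff]
      exact ⟨ha, hw, hy, hz⟩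
    · rw [hcard, card_four hX.ne (Ne.symm hyaw.1) hza.symm (Ne.symm hyaw.2) hzw.symm hY.ne]
end

section
/- Let G be a finite simple graph and let M₁ and M₂ be matchings in G such that every vertex matched by M₁ is also matched by M₂. Then the number of vertices of G that are incident to at least one edge of M₁△M₂ is even. -/
open scoped Classical symmDiff

/-- The number of vertices covered by a matching is even. -/
theorem IsMatching.even_card_matched {V : Type*} [Fintype V] [DecidableEq V]
    {G : SimpleGraph V} {M : Finset (Sym2 V)} (h : IsMatching G M) :
    Even (Finset.univ.filter (fun v : V => Matched M v)).card := by
  have hU : Finset.univ.filter (fun v : V => Matched M v) = M.biUnion Sym2.toFinset := by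
    ext v
    simp only [Finset.mem_filter, Finset.mem_univ, true_and, Finset.mem_biUnion, Sym2.mem_toFinset]
    exact Iff.rfl
  rw [hU, Finset.card_biUnion]
  · refine Finset.even_sum _ fun e he => ?_
    rw [Sym2.card_toFinset_of_not_isDiag e (G.not_isDiag_of_mem_edgeSet (h.1 he))]
    exact even_two
  · intro e he f hf hef
    refine Finset.disjoint_left.2 ?_
    intro v hv hv'
    exact h.2 e he f hf hef v (Sym2.mem_toFinset.1 hv) (Sym2.mem_toFinset.1 hv')

theorem IsMatching.mono {V : Type*} {G : SimpleGraph V} {M N : Finset (Sym2 V)}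
    (h : IsMatching G M) (hNM : N ⊆ M) : IsMatching G N :=
  ⟨fun _ he => h.1 (hNM he), fun e he f hf => h.2 e (hNM he) f (hNM hf)⟩

/-- If `M₁`, `M₂` are matchings in a finite simple graph `G` such that every
vertex matched by `M₁` is also matched by `M₂`, then the number of vertices
incident to at least one edge of `M₁ △ M₂` is even. -/
theorem stmt2 {V : Type*} [Fintype V] [DecidableEq V] (G : SimpleGraph V)
    (M₁ M₂ : Finset (Sym2 V)) (h₁ : IsMatching G M₁) (h₂ : IsMatching G M₂)
    (hsub : ∀ v : V, Matched M₁ v → Matched M₂ v) :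
    Even (Finset.univ.filter (fun v : V => ∃ e ∈ M₁ ∆ M₂, v ∈ e)).card := by
  have hS : ∀ v : V, (∃ e ∈ M₁ ∆ M₂, v ∈ e) ↔ Matched (M₂ \ M₁) v := by
    intro v
    constructor
    · rintro ⟨e, he, hv⟩
      rcases Finset.mem_symmDiff.1 he with ⟨he₁, he₂⟩ | ⟨he₂, he₁⟩
      · obtain ⟨f, hf, hvf⟩ := hsub v ⟨e, he₁, hv⟩
        refine ⟨f, Finset.mem_sdiff.2 ⟨hf, fun hf₁ => ?_⟩, hvf⟩
        exact h₁.2 e he₁ f hf₁ (fun hef => he₂ (hef ▸ hf)) v hv hvf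
      · exact ⟨e, Finset.mem_sdiff.2 ⟨he₂, he₁⟩, hv⟩
    · rintro ⟨e, he, hv⟩
      exact ⟨e, Finset.mem_symmDiff.2 (Or.inr (Finset.mem_sdiff.1 he)), hv⟩
  have key := (h₂.mono (N := M₂ \ M₁) Finset.sdiff_subset).even_card_matched
  simpa only [hS] using key
end

section
/- Let G be a finite simple graph, let M be a matching in G, let P be an augmenting path in G with respect to M, and let Q be an augmenting path in G with respect to M△P. Then in the graph on the vertex set of G whose edge set is P△Q, every vertex has degree at most 2. -/
open scoped Classical symmDiff

/-- The degree of a vertex `v` in the graph whose edge set is the finite edge set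
`S`: the number of edges of `S` containing `v`. -/
noncomputable def edgeDeg {V : Type*} (S : Finset (Sym2 V)) (v : V) : ℕ :=
  (S.filter (fun e => v ∈ e)).card

/-- The `i`-th edge of a path contains its `j`-th vertex only if `j` is `i` or `i + 1`. -/
theorem SimpleGraph.Walk.IsPath.getVert_mem_edges_getElem_iff {V : Type*} {G : SimpleGraph V}
    {a b : V} {p : G.Walk a b} (hp : p.IsPath) {i j : ℕ} (hi : i < p.edges.length)
    (hj : j ≤ p.length) : p.getVert j ∈ p.edges[i] ↔ j = i ∨ j = i + 1 := by
  have hi' : i < p.length := by simpa using hi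
  rw [SimpleGraph.Walk.getElem_edges, Sym2.mem_iff]
  refine or_congr ⟨fun h => hp.getVert_injOn hj hi'.le h, fun h => h ▸ rfl⟩
    ⟨fun h => hp.getVert_injOn hj hi' h, fun h => h ▸ rfl⟩

/-- At a vertex of an augmenting path, the path either has a single edge and the vertex is exposed,
or it has exactly two edges, one of which lies in the matching. -/
theorem IsAugPath.edges_at {V : Type*} {G : SimpleGraph V} {N : Finset (Sym2 V)} {a b : V}
    {p : G.Walk a b} (hp : IsAugPath G N p) {v : V} {e : Sym2 V} (he : e ∈ p.edges) (hv : v ∈ e) :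
    (¬ Matched N v ∧ ∀ f ∈ p.edges, v ∈ f → f = e) ∨
      ∃ e₁ ∈ p.edges, ∃ e₂ ∈ p.edges, v ∈ e₁ ∧ v ∈ e₂ ∧ e₁ ∈ N ∧ e₂ ∉ N ∧
        ∀ f ∈ p.edges, v ∈ f → f = e₁ ∨ f = e₂ := by
  obtain ⟨j, rfl, hj⟩ := SimpleGraph.Walk.mem_support_iff_exists_getVert.mp
    (p.mem_support_of_mem_edges he hv)
  have hlen := p.length_edges
  have key : ∀ f ∈ p.edges, p.getVert j ∈ f →
      ∃ (i : ℕ) (h : i < p.edges.length), p.edges[i] = f ∧ (j = i ∨ j = i + 1) := by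
    intro f hf hvf
    obtain ⟨i, hi, rfl⟩ := List.getElem_of_mem hf
    exact ⟨i, hi, rfl, (hp.isPath.getVert_mem_edges_getElem_iff hi hj).mp hvf⟩
  obtain rfl | hj0 := Nat.eq_zero_or_pos j
  · refine Or.inl ⟨by simpa using hp.expA, fun f hf hvf => ?_⟩
    obtain ⟨i, hi, rfl, hij⟩ := key f hf hvf
    obtain ⟨k, hk, rfl, hkj⟩ := key e he hv
    obtain rfl : i = k := by omega
    rfl
  obtain rfl | hjl := hj.eq_or_lt
  · refine Or.inl ⟨by simpa using hp.expB, fun f hf hvf => ?_⟩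
    obtain ⟨i, hi, rfl, hij⟩ := key f hf hvf
    obtain ⟨k, hk, rfl, hkj⟩ := key e he hv
    obtain rfl : i = k := by omega
    rfl
  obtain ⟨j, rfl⟩ : ∃ k, j = k + 1 := ⟨j - 1, by omega⟩
  have h₁ : j < p.edges.length := by omega
  have h₂ : j + 1 < p.edges.length := by omega
  have m₁ := (hp.isPath.getVert_mem_edges_getElem_iff h₁ hj).mpr (Or.inr rfl)
  have m₂ := (hp.isPath.getVert_mem_edges_getElem_iff h₂ hj).mpr (Or.inl rfl)
  have hcases : ∀ f ∈ p.edges, p.getVert (j + 1) ∈ f → f = p.edges[j] ∨ f = p.edges[j + 1] := by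
    intro f hf hvf
    obtain ⟨i, hi, rfl, hij⟩ := key f hf hvf
    obtain rfl | rfl : i = j + 1 ∨ i = j := by omega
    exacts [Or.inr rfl, Or.inl rfl]
  have halt := hp.alt j h₂
  by_cases hN : p.edges[j] ∈ N
  · exact Or.inr ⟨_, List.getElem_mem h₁, _, List.getElem_mem h₂, m₁, m₂, hN, halt.mp hN, hcases⟩
  · exact Or.inr ⟨_, List.getElem_mem h₂, _, List.getElem_mem h₁, m₂, m₁,
      not_not.mp (mt halt.mpr hN), hN, fun f hf hvf => (hcases f hf hvf).symm⟩

/-- If `P` is an augmenting path with respect to the matching `M` and `Q` is an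
augmenting path with respect to `M △ P`, then in the graph on the vertex set of
`G` whose edge set is `P △ Q`, every vertex has degree at most `2`. -/
theorem stmt4 {V : Type*} [Fintype V] [DecidableEq V] (G : SimpleGraph V)
    (M : Finset (Sym2 V)) (hM : IsMatching G M)
    {a b : V} (P : G.Walk a b) (hP : IsAugPath G M P)
    {c d : V} (Q : G.Walk c d) (hQ : IsAugPath G (M ∆ P.edges.toFinset) Q) :
    ∀ v : V, edgeDeg (P.edges.toFinset ∆ Q.edges.toFinset) v ≤ 2 := by
  intro v
  have hle : ∀ e₁ e₂ : Sym2 V,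
      (∀ f, (f ∈ P.edges ∧ f ∉ Q.edges ∨ f ∈ Q.edges ∧ f ∉ P.edges) → v ∈ f → f = e₁ ∨ f = e₂) →
      edgeDeg (P.edges.toFinset ∆ Q.edges.toFinset) v ≤ 2 := by
    intro e₁ e₂ h
    refine (Finset.card_le_card (t := {e₁, e₂}) fun f hf => ?_).trans Finset.card_le_two
    simp only [Finset.mem_filter, Finset.mem_symmDiff, List.mem_toFinset] at hf
    simpa using h f hf.1 hf.2
  have hMv : ∀ e ∈ M, ∀ f ∈ M, v ∈ e → v ∈ f → e = f := fun e he f hf hve hvf =>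
    by_contra fun hne => hM.2 e he f hf hne v hve hvf
  by_cases hPv : ∃ e ∈ P.edges, v ∈ e
  · obtain ⟨e, he, hve⟩ := hPv
    by_cases hQv : ∃ g ∈ Q.edges, v ∈ g
    · obtain ⟨g, hg, hvg⟩ := hQv
      have hPe := hP.edges_at he hve
      have hQg := hQ.edges_at hg hvg
      simp only [Matched, Finset.mem_symmDiff, List.mem_toFinset] at hPe hQg
      obtain ⟨hexp, hPe⟩ | ⟨e₁, he₁, e₂, he₂, hv₁, hv₂, hM₁, hM₂, hPe⟩ := hPe <;>
      obtain ⟨hexpQ, hQg⟩ | ⟨g₁, hg₁, g₂, hg₂, hw₁, hw₂, hN₁, hN₂, hQg⟩ := hQg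
      · exact (hexpQ ⟨e, Or.inr ⟨he, fun h => hexp ⟨e, h, hve⟩⟩, hve⟩).elim
      · exact hle g₂ g₂ (by grind)
      · exact (hexpQ ⟨e₂, Or.inr ⟨he₂, hM₂⟩, hv₂⟩).elim
      · exact hle e₁ g₂ (by grind)
    · obtain ⟨-, h⟩ | ⟨e₁, -, e₂, -, -, -, -, -, h⟩ := hP.edges_at he hve
      · exact hle e e (by grind)
      · exact hle e₁ e₂ (by grind)
  · by_cases hQv : ∃ g ∈ Q.edges, v ∈ g
    · obtain ⟨g, hg, hvg⟩ := hQv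
      obtain ⟨-, h⟩ | ⟨e₁, -, e₂, -, -, -, -, -, h⟩ := hQ.edges_at hg hvg
      · exact hle g g (by grind)
      · exact hle e₁ e₂ (by grind)
    · exact hle s(v, v) s(v, v) (by grind)
end

section
/- Let G be a finite simple graph, let M be a matching in G, let P be an augmenting path in G with respect to M, and let Q be an augmenting path in G with respect to M△P. Then the two endpoints of P and the two endpoints of Q are four pairwise distinct vertices, and in the graph on the vertex set of G whose edge set is P△Q, a vertex has odd degree if and only if it is one of these four vertices. -/
open scoped Classical symmDiff

theorem edgeDeg_edges_odd_iff {V : Type*} {G : SimpleGraph V} {a b : V} {p : G.Walk a b}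
    (hp : p.IsPath) (hab : a ≠ b) (v : V) :
    Odd (edgeDeg p.edges.toFinset v) ↔ v = a ∨ v = b := by
  have h : edgeDeg p.edges.toFinset v = p.edges.countP (fun e => v ∈ e) := by
    rw [edgeDeg, List.countP_eq_length_filter, ← List.toFinset_card_of_nodup
      (hp.isTrail.edges_nodup.filter _)]
    congr 1
    ext e
    simp
  rw [h, ← Nat.not_even_iff_odd, hp.isTrail.even_countP_edges_iff]
  tauto

theorem edgeDeg_symmDiff_odd_iff {V : Type*} (S T : Finset (Sym2 V)) (v : V) :
    Odd (edgeDeg (S ∆ T) v) ↔ ¬ (Odd (edgeDeg S v) ↔ Odd (edgeDeg T v)) := by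
  have hd : Disjoint ((S \ T).filter (v ∈ ·)) ((T \ S).filter (v ∈ ·)) :=
    Finset.disjoint_filter_filter disjoint_sdiff_sdiff
  have hST : edgeDeg (S ∆ T) v = edgeDeg (S \ T) v + edgeDeg (T \ S) v := by
    rw [edgeDeg, edgeDeg, edgeDeg, ← Finset.card_union_of_disjoint hd, ← Finset.filter_union]
    rfl
  have split (A B : Finset (Sym2 V)) : edgeDeg A v = edgeDeg (A \ B) v + edgeDeg (A ∩ B) v := by
    rw [edgeDeg, edgeDeg, edgeDeg, ← Finset.card_union_of_disjoint
      (Finset.disjoint_filter_filter (Finset.disjoint_sdiff_inter A B)), ← Finset.filter_union,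
      Finset.sdiff_union_inter]
  have hS := split S T
  have hT := split T S
  rw [Finset.inter_comm] at hT
  rw [hST, hS, hT]
  simp only [Nat.odd_iff]
  omega

/-- Every vertex of an augmenting path is matched after augmenting along that path. -/
theorem IsAugPath.matched_symmDiff {V : Type*} {G : SimpleGraph V} {M : Finset (Sym2 V)}
    {a b : V} {p : G.Walk a b} (hp : IsAugPath G M p) {v : V} (hv : v ∈ p.support) :
    Matched (M ∆ p.edges.toFinset) v := by
  suffices h : ∃ e ∈ p.edges, e ∉ M ∧ v ∈ e by
    obtain ⟨e, hep, heM, hve⟩ := h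
    exact ⟨e, Finset.mem_symmDiff.2 (.inr ⟨List.mem_toFinset.2 hep, heM⟩), hve⟩
  obtain ⟨i, rfl, hi⟩ := SimpleGraph.Walk.mem_support_iff_exists_getVert.1 hv
  have hlen := p.length_edges
  have hpos := hp.pos
  rcases i with _ | i
  · have h0 : 0 < p.edges.length := by omega
    refine ⟨p.edges[0], List.getElem_mem h0, fun hM => hp.expA ⟨_, hM, ?_⟩, ?_⟩ <;>
      simp [SimpleGraph.Walk.getElem_edges]
  · have h1 : i < p.edges.length := by omega
    by_cases hM : p.edges[i] ∈ M
    · by_cases hlast : i + 1 = p.length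
      · refine absurd ⟨_, hM, ?_⟩ hp.expB
        rw [SimpleGraph.Walk.getElem_edges, hlast, p.getVert_length]
        exact Sym2.mem_mk_right _ _
      · have h2 : i + 1 < p.edges.length := by omega
        refine ⟨p.edges[i + 1], List.getElem_mem h2, (hp.alt i h2).1 hM, ?_⟩
        rw [SimpleGraph.Walk.getElem_edges]
        exact Sym2.mem_mk_left _ _
    · refine ⟨p.edges[i], List.getElem_mem h1, hM, ?_⟩
      rw [SimpleGraph.Walk.getElem_edges]
      exact Sym2.mem_mk_right _ _

/-- If `P` is an augmenting path with respect to the matching `M` and `Q` is an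
augmenting path with respect to `M △ P`, then the endpoints `a`, `b` of `P` and
`c`, `d` of `Q` are four pairwise distinct vertices, and in the graph whose edge
set is `P △ Q`, a vertex has odd degree if and only if it is one of `a, b, c, d`. -/
theorem stmt5 {V : Type*} [Fintype V] [DecidableEq V] (G : SimpleGraph V)
    (M : Finset (Sym2 V)) (hM : IsMatching G M)
    {a b : V} (P : G.Walk a b) (hP : IsAugPath G M P)
    {c d : V} (Q : G.Walk c d) (hQ : IsAugPath G (M ∆ P.edges.toFinset) Q) :
    ({a, b, c, d} : Finset V).card = 4 ∧
    (∀ v : V, Odd (edgeDeg (P.edges.toFinset ∆ Q.edges.toFinset) v) ↔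
      (v = a ∨ v = b ∨ v = c ∨ v = d)) := by
  obtain rfl : ‹DecidableEq V› = Classical.decEq V := Subsingleton.elim _ _
  have hc : c ∉ P.support := fun h => hQ.expA (by convert hP.matched_symmDiff h)
  have hd : d ∉ P.support := fun h => hQ.expB (by convert hP.matched_symmDiff h)
  have hac : a ≠ c := fun h => hc (h ▸ P.start_mem_support)
  have hbc : b ≠ c := fun h => hc (h ▸ P.end_mem_support)
  have had : a ≠ d := fun h => hd (h ▸ P.start_mem_support)
  have hbd : b ≠ d := fun h => hd (h ▸ P.end_mem_support)
  have hab := hP.ne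
  have hcd := hQ.ne
  refine ⟨by simp [Finset.card_insert_of_notMem, *], fun v => ?_⟩
  have hdeg := edgeDeg_symmDiff_odd_iff P.edges.toFinset Q.edges.toFinset v
  rw [edgeDeg_edges_odd_iff hP.isPath hab, edgeDeg_edges_odd_iff hQ.isPath hcd] at hdeg
  convert hdeg using 1
  grind
end

section
/- Let G be a finite simple graph and let M and M′ be matchings in G such that every vertex matched by M is also matched by M′. Suppose there is an edge {u, v} ∈ M′ ∖ M such that both u and v are matched by M, and suppose there is a vertex z that is exposed with respect to M but matched by M′. Then at least 6 distinct vertices of G are incident to an edge of M△M′. -/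
open scoped Classical symmDiff

theorem matched_iff_exists_mk_mem {V : Type*} {M : Finset (Sym2 V)} {x : V} :
    Matched M x ↔ ∃ y, s(x, y) ∈ M := by
  constructor
  · rintro ⟨e, he, y, rfl⟩
    exact ⟨y, he⟩
  · rintro ⟨y, hy⟩
    exact ⟨_, hy, Sym2.mem_mk_left x y⟩

theorem IsMatching.ne_of_mk_mem {V : Type*} {G : SimpleGraph V} {M : Finset (Sym2 V)}
    (hM : IsMatching G M) {x y : V} (h : s(x, y) ∈ M) : x ≠ y :=
  G.ne_of_adj (hM.1 h)

theorem IsMatching.eq_of_mk_mem {V : Type*} {G : SimpleGraph V} {M : Finset (Sym2 V)}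
    (hM : IsMatching G M) {x y w : V} (hy : s(x, y) ∈ M) (hw : s(x, w) ∈ M) : y = w := by
  by_contra hne
  exact hM.2 _ hy _ hw (fun h => hne (Sym2.congr_right.mp h)) x
    (Sym2.mem_mk_left x y) (Sym2.mem_mk_left x w)

theorem Finset.six_le_card_of_nodup {α : Type*} {s : Finset α} {a b c d e f : α}
    (hnd : [a, b, c, d, e, f].Nodup) (hs : ∀ x ∈ [a, b, c, d, e, f], x ∈ s) : 6 ≤ s.card := by
  calc 6 = [a, b, c, d, e, f].toFinset.card := (List.toFinset_card_of_nodup hnd).symm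
    _ ≤ s.card := Finset.card_le_card fun x hx => hs x (List.mem_toFinset.mp hx)

/-- If `M`, `M'` are matchings such that every vertex matched by `M` is matched
by `M'`, there is an edge `{u, v} ∈ M' \ M` with both `u` and `v` matched by `M`,
and there is a vertex `z` exposed with respect to `M` but matched by `M'`, then
at least `6` distinct vertices are incident to an edge of `M △ M'`. -/
theorem stmt11 {V : Type*} [Fintype V] [DecidableEq V] (G : SimpleGraph V)
    (M M' : Finset (Sym2 V)) (hM : IsMatching G M) (hM' : IsMatching G M')
    (hsub : ∀ v : V, Matched M v → Matched M' v)
    (u v : V) (huv : s(u, v) ∈ M' ∧ s(u, v) ∉ M)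
    (hu : Matched M u) (hv : Matched M v)
    (z : V) (hz : ¬ Matched M z) (hz' : Matched M' z) :
    6 ≤ (Finset.univ.filter (fun x : V => ∃ f ∈ M ∆ M', x ∈ f)).card := by
  have mem_of_left {x y : V} (h : s(x, y) ∈ M) (h' : s(x, y) ∉ M') :
      x ∈ Finset.univ.filter (fun x : V => ∃ f ∈ M ∆ M', x ∈ f) := by
    simpa using ⟨s(x, y), Finset.mem_symmDiff.mpr (Or.inl ⟨h, h'⟩), Sym2.mem_mk_left x y⟩
  have mem_of_right {x y : V} (h : s(x, y) ∈ M') (h' : s(x, y) ∉ M) :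
      x ∈ Finset.univ.filter (fun x : V => ∃ f ∈ M ∆ M', x ∈ f) := by
    simpa using ⟨s(x, y), Finset.mem_symmDiff.mpr (Or.inr ⟨h, h'⟩), Sym2.mem_mk_left x y⟩
  have unique {x y w : V} : s(x, y) ∈ M → s(x, w) ∈ M → y = w := hM.eq_of_mk_mem
  have unique' {x y w : V} : s(x, y) ∈ M' → s(x, w) ∈ M' → y = w := hM'.eq_of_mk_mem
  have ne {x y : V} : s(x, y) ∈ M → x ≠ y := hM.ne_of_mk_mem
  have ne' {x y : V} : s(x, y) ∈ M' → x ≠ y := hM'.ne_of_mk_mem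
  have swap {x y : V} : s(x, y) ∈ M → s(y, x) ∈ M := fun h => Sym2.eq_swap ▸ h
  have swap' {x y : V} : s(x, y) ∈ M' → s(y, x) ∈ M' := fun h => Sym2.eq_swap ▸ h
  obtain ⟨huv', huvM⟩ := huv
  obtain ⟨a, ha⟩ := matched_iff_exists_mk_mem.mp hu
  obtain ⟨b, hb⟩ := matched_iff_exists_mk_mem.mp hv
  obtain ⟨a', ha'⟩ := matched_iff_exists_mk_mem.mp
    (hsub a (matched_iff_exists_mk_mem.mpr ⟨u, swap ha⟩))
  obtain ⟨b', hb'⟩ := matched_iff_exists_mk_mem.mp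
    (hsub b (matched_iff_exists_mk_mem.mpr ⟨v, swap hb⟩))
  have hav : a ≠ v := by rintro rfl; exact huvM ha
  have hbu : b ≠ u := by rintro rfl; exact huvM (swap hb)
  have hab : a ≠ b := by rintro rfl; exact ne' huv' (unique (swap ha) (swap hb))
  have hau' : s(u, a) ∉ M' := fun h => hav (unique' h huv')
  have hbv' : s(v, b) ∉ M' := fun h => hbu (unique' h (swap' huv'))
  have hu_mem := mem_of_left ha hau'
  have hv_mem := mem_of_left hb hbv'
  have ha_mem := mem_of_left (swap ha) (fun h => hau' (swap' h))
  have hb_mem := mem_of_left (swap hb) (fun h => hbv' (swap' h))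
  have hua := ne ha
  have hvb := ne hb
  have huv_ne := ne' huv'
  by_cases hba : a' = b
  · subst hba
    obtain ⟨z', hzz'⟩ := matched_iff_exists_mk_mem.mp hz'
    have not_matched {y : V} (h : s(z, y) ∈ M) : False :=
      hz (matched_iff_exists_mk_mem.mpr ⟨y, h⟩)
    have hzu : z ≠ u := by rintro rfl; exact hz hu
    have hzv : z ≠ v := by rintro rfl; exact hz hv
    have hza : z ≠ a := by rintro rfl; exact not_matched (swap ha)
    have hzb : z ≠ a' := by rintro rfl; exact not_matched (swap hb)
    have hz'u : z' ≠ u := by rintro rfl; exact hzv (unique' (swap' hzz') huv')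
    have hz'v : z' ≠ v := by rintro rfl; exact hzu (unique' (swap' hzz') (swap' huv'))
    have hz'a : z' ≠ a := by rintro rfl; exact hzb (unique' (swap' hzz') ha')
    have hz'b : z' ≠ a' := by rintro rfl; exact hza (unique' (swap' hzz') (swap' ha'))
    have hzz_ne := ne' hzz'
    have hz_mem := mem_of_right hzz' not_matched
    have hz'_mem := mem_of_right (swap' hzz') (fun h => not_matched (swap h))
    refine Finset.six_le_card_of_nodup (a := u) (b := v) (c := a) (d := a') (e := z) (f := z')
      ?_ ?_
    · grind
    · simp only [List.forall_mem_cons]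
      exact ⟨hu_mem, hv_mem, ha_mem, hb_mem, hz_mem, hz'_mem, by simp⟩
  · have ha'u : a' ≠ u := by rintro rfl; exact hav (unique' (swap' ha') huv')
    have ha'v : a' ≠ v := by rintro rfl; exact hua (unique' (swap' huv') (swap' ha'))
    have hb'u : b' ≠ u := by rintro rfl; exact hvb (unique' huv' (swap' hb'))
    have hb'v : b' ≠ v := by rintro rfl; exact hbu (unique' (swap' hb') (swap' huv'))
    have hb'a : b' ≠ a := by rintro rfl; exact hba (unique' ha' (swap' hb'))
    have hab' : a' ≠ b' := by rintro rfl; exact hab (unique' (swap' ha') (swap' hb'))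
    have haa' := ne' ha'
    have hbb' := ne' hb'
    have ha'_mem := mem_of_right (swap' ha') (fun h => ha'u (unique (swap h) (swap ha)))
    have hb'_mem := mem_of_right (swap' hb') (fun h => hb'v (unique (swap h) (swap hb)))
    refine Finset.six_le_card_of_nodup (a := u) (b := v) (c := a) (d := b) (e := a') (f := b')
      ?_ ?_
    · grind
    · simp only [List.forall_mem_cons]
      exact ⟨hu_mem, hv_mem, ha_mem, hb_mem, ha'_mem, hb'_mem, by simp⟩
end

section
/- Let G be a complete bipartite graph on L ∪ R with nonnegative edge weights w, let M be a matching in G, and let u ∈ L be exposed with respect to M. Assume at least one vertex of R is exposed with respect to M. For a matched vertex v ∈ R with partner M(v), define the loss ℓ_v := w(M(v), v) − max_{v′ ∈ R exposed} w(M(v), v′), and define ℓ_v := 0 for exposed v ∈ R (with max over the empty set defined as 0). Let p be the maximum of the following quantities over all choices: w(u, v′) for v′ ∈ R exposed, and w(u, v) − w(M(v), v) + w(M(v), v′′) for v ∈ R matched and v′′ ∈ R exposed (p is the largest profit achievable by augmenting along a path of length at most 3 starting at u). Then for every vertex v ∈ R, p ≥ w(u, v) − ℓ_v. -/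
open scoped Classical

/-- `M` is a matching in the complete bipartite graph on `L ∪ R`:
a set of (left, right) pairs no two of which share an endpoint. -/
def IsBipMatching {L R : Type*} (M : Finset (L × R)) : Prop :=
  ∀ p ∈ M, ∀ q ∈ M, p ≠ q → p.1 ≠ q.1 ∧ p.2 ≠ q.2

/-- The set of right-side vertices exposed (unmatched) with respect to `M`. -/
noncomputable def exposedR {L R : Type*} [Fintype R] (M : Finset (L × R)) : Finset R :=
  Finset.univ.filter (fun r => ∀ x : L, (x, r) ∉ M)

/-- `max_{v' ∈ R exposed w.r.t. M} w m v'`, with the maximum over the empty set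
defined as `0`. -/
noncomputable def maxExpW {L R : Type*} [Fintype R] (w : L → R → ℝ)
    (M : Finset (L × R)) (m : L) : ℝ :=
  if h : (exposedR M).Nonempty then (exposedR M).sup' h (w m) else 0

/-- The total weight of the matching `M`. -/
noncomputable def wSum {L R : Type*} (w : L → R → ℝ) (M : Finset (L × R)) : ℝ :=
  ∑ p ∈ M, w p.1 p.2

/-- Marginal-profit lemma: let `u ∈ L` be exposed with respect to the matching
`M` in a complete bipartite graph with nonnegative weights `w`, and suppose some
vertex of `R` is exposed.  For matched `v ∈ R` with partner `m`, the loss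
`ℓ v = w m v - max_{v' exposed} w m v'`, and `ℓ v = 0` for exposed `v`.  If `p`
is the maximum profit achievable by augmenting along a path of length at most 3
starting at `u`, i.e. the maximum of all quantities `w u v'` (`v'` exposed) and
`w u v - w m v + w m v''` (`(m, v) ∈ M`, `v''` exposed), then
`p ≥ w u v - ℓ v` for every `v ∈ R`. -/
theorem stmt12 {L R : Type*} [Fintype L] [Fintype R] [DecidableEq L] [DecidableEq R]
    (w : L → R → ℝ) (hw : ∀ (x : L) (y : R), 0 ≤ w x y)
    (M : Finset (L × R)) (hM : IsBipMatching M)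
    (u : L) (hu : ∀ r : R, (u, r) ∉ M)
    (hne : (exposedR M).Nonempty)
    (ℓ : R → ℝ)
    (hℓ1 : ∀ (v : R) (m : L), (m, v) ∈ M → ℓ v = w m v - maxExpW w M m)
    (hℓ2 : ∀ v ∈ exposedR M, ℓ v = 0)
    (p : ℝ)
    (hp : IsGreatest
      ({x : ℝ | ∃ v' ∈ exposedR M, x = w u v'} ∪
       {x : ℝ | ∃ (v : R) (m : L) (v'' : R), (m, v) ∈ M ∧ v'' ∈ exposedR M ∧
          x = w u v - w m v + w m v''}) p) :
    ∀ v : R, w u v - ℓ v ≤ p := by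
  intro v
  by_cases hv : v ∈ exposedR M
  · rw [hℓ2 v hv, sub_zero]
    exact hp.2 (Or.inl ⟨v, hv, rfl⟩)
  · obtain ⟨m, hm⟩ : ∃ m, (m, v) ∈ M := by
      simpa [exposedR] using hv
    obtain ⟨v'', hv'', hmax⟩ := Finset.exists_mem_eq_sup' hne (w m)
    have hprofit : w u v - w m v + w m v'' ≤ p :=
      hp.2 (Or.inr ⟨v, m, v'', hm, hv'', rfl⟩)
    rw [hℓ1 v m hm, maxExpW, dif_pos hne, hmax]
    linarith
end

section
/- Let G be a complete bipartite graph on L ∪ R with nonnegative edge weights w, let M be a matching in G, and let u ∈ L be exposed with respect to M; assume at least one vertex of R is exposed with respect to M. Let M′ be obtained from M in one of the following two ways: (i) M′ = M ∪ {(u, v*)} for some exposed v* ∈ R, or (ii) M′ = (M ∖ {(M(v), v)}) ∪ {(u, v), (M(v), v_tail)} for some matched v ∈ R and some v_tail ∈ R exposed with respect to M satisfying w(M(v), v_tail) = max_{v′ ∈ R exposed} w(M(v), v′); and assume the chosen option maximizes w(M′) − w(M) over all options of forms (i) and (ii). For any matching N, define the loss ℓ^N_v := w(N(v), v) − max_{v′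 ∈ R exposed w.r.t. N} w(N(v), v′) if v ∈ R is matched by N (with max over the empty set defined as 0), and ℓ^N_v := 0 if v is exposed with respect to N. Then for every vertex v ∈ R, ℓ^{M′}_v ≥ ℓ^{M}_v. -/
open scoped Classical

/-- One step of the online algorithm for the newly arrived exposed vertex `u`:
`N` is obtained from `M` either (i) by matching `u` to an exposed vertex `v*`,
or (ii) by taking a matched vertex `v` away from its partner `m`, matching `u`
to `v`, and rematching `m` to an exposed vertex `v_tail` maximizing
`w m ·` over exposed vertices. -/
def StepOption {L R : Type*} [Fintype R] (w : L → R → ℝ)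
    (M : Finset (L × R)) (u : L) (N : Finset (L × R)) : Prop :=
  (∃ v' ∈ exposedR M, N = insert (u, v') M) ∨
  (∃ (v : R) (m : L) (vtail : R), (m, v) ∈ M ∧ vtail ∈ exposedR M ∧
      w m vtail = maxExpW w M m ∧
      N = insert (u, v) (insert (m, vtail) (M.erase (m, v))))

theorem mem_exposedR {L R : Type*} [Fintype R] {M : Finset (L × R)} {r : R} :
    r ∈ exposedR M ↔ ∀ x : L, (x, r) ∉ M := by
  simp [exposedR]

theorem le_maxExpW {L R : Type*} [Fintype R] (w : L → R → ℝ) {M : Finset (L × R)} (m : L)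
    {r : R} (hr : r ∈ exposedR M) : w m r ≤ maxExpW w M m := by
  rw [maxExpW, dif_pos ⟨r, hr⟩]
  exact Finset.le_sup' (w m) hr

theorem maxExpW_le {L R : Type*} [Fintype R] {w : L → R → ℝ} {M : Finset (L × R)} {m : L}
    {c : ℝ} (hc : 0 ≤ c) (h : ∀ r ∈ exposedR M, w m r ≤ c) : maxExpW w M m ≤ c := by
  unfold maxExpW
  split_ifs with hne
  · exact Finset.sup'_le hne (w m) h
  · exact hc

theorem maxExpW_nonneg {L R : Type*} [Fintype R] {w : L → R → ℝ} (hw : ∀ x y, 0 ≤ w x y)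
    (M : Finset (L × R)) (m : L) : 0 ≤ maxExpW w M m := by
  by_cases hne : (exposedR M).Nonempty
  · obtain ⟨r, hr⟩ := hne
    exact (hw m r).trans (le_maxExpW w m hr)
  · simp [maxExpW, hne]

theorem maxExpW_mono {L R : Type*} [Fintype R] {w : L → R → ℝ} (hw : ∀ x y, 0 ≤ w x y)
    {M N : Finset (L × R)} (h : exposedR N ⊆ exposedR M) (m : L) :
    maxExpW w N m ≤ maxExpW w M m :=
  maxExpW_le (maxExpW_nonneg hw M m) fun _ hr => le_maxExpW w m (h hr)

theorem wSum_insert {L R : Type*} (w : L → R → ℝ) {M : Finset (L × R)} {u : L} {v : R}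
    (h : (u, v) ∉ M) : wSum w (insert (u, v) M) = w u v + wSum w M :=
  Finset.sum_insert h

/-- The weight after augmenting `M` along the path `u, v, m, t`. -/
theorem wSum_augment {L R : Type*} [Fintype R] (w : L → R → ℝ) {M : Finset (L × R)} {u m : L}
    {v t : R} (hu : ∀ r, (u, r) ∉ M) (hmv : (m, v) ∈ M) (ht : t ∈ exposedR M) :
    wSum w (insert (u, v) (insert (m, t) (M.erase (m, v)))) =
      wSum w M + w u v + w m t - w m v := by
  have hum : u ≠ m := fun h => hu v (h ▸ hmv)
  have hmt : (m, t) ∉ M.erase (m, v) := fun h =>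
    mem_exposedR.1 ht m (Finset.mem_of_mem_erase h)
  have huv : (u, v) ∉ insert (m, t) (M.erase (m, v)) := by
    simp [hum, hu]
  rw [wSum_insert w huv, wSum_insert w hmt]
  have : wSum w (M.erase (m, v)) + w m v = wSum w M :=
    Finset.sum_erase_add M (fun p => w p.1 p.2) hmv
  linarith

theorem StepOption.exposedR_subset {L R : Type*} [Fintype R] {w : L → R → ℝ}
    {M N : Finset (L × R)} {u : L} (h : StepOption w M u N) : exposedR N ⊆ exposedR M := by
  intro r hr
  rw [mem_exposedR] at hr ⊢
  intro x hx
  rcases h with ⟨v, -, rfl⟩ | ⟨v, m, t, -, -, -, rfl⟩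
  · exact hr x (Finset.mem_insert_of_mem hx)
  · by_cases hxr : (x, r) = (m, v)
    · obtain ⟨rfl, rfl⟩ := Prod.mk.inj hxr
      exact hr u (Finset.mem_insert_self _ _)
    · exact hr x (by simp_all)

/-- A step of maximal profit gains at least the weight of every edge from `u` to an exposed
vertex. -/
theorem maxExpW_le_gain {L R : Type*} [Fintype R] {w : L → R → ℝ} {M M' : Finset (L × R)}
    {u : L} (hu : ∀ r, (u, r) ∉ M) (hne : (exposedR M).Nonempty)
    (hmax : ∀ N, StepOption w M u N → wSum w N - wSum w M ≤ wSum w M' - wSum w M) :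
    maxExpW w M u ≤ wSum w M' - wSum w M := by
  rw [maxExpW, dif_pos hne]
  refine Finset.sup'_le hne (w u) fun r hr => ?_
  have := hmax _ (Or.inl ⟨r, hr, rfl⟩)
  rw [wSum_insert w (hu r)] at this
  linarith

/-- Monotonicity of losses: if `M'` is obtained from the matching `M` by the
online algorithm step at the newly arrived exposed vertex `u` (choosing, among
options (i) and (ii), one maximizing the marginal profit `w(M') - w(M)`), then
the loss of every vertex `v ∈ R` with respect to `M'` is at least its loss with
respect to `M`. -/
theorem stmt13 {L R : Type*} [Fintype L] [Fintype R] [DecidableEq L] [DecidableEq R]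
    (w : L → R → ℝ) (hw : ∀ (x : L) (y : R), 0 ≤ w x y)
    (M : Finset (L × R)) (hM : IsBipMatching M)
    (u : L) (hu : ∀ r : R, (u, r) ∉ M)
    (hne : (exposedR M).Nonempty)
    (M' : Finset (L × R)) (hM'opt : StepOption w M u M')
    (hmax : ∀ N : Finset (L × R), StepOption w M u N →
      wSum w N - wSum w M ≤ wSum w M' - wSum w M)
    (ℓ ℓ' : R → ℝ)
    (hℓ1 : ∀ (v : R) (m : L), (m, v) ∈ M → ℓ v = w m v - maxExpW w M m)
    (hℓ2 : ∀ v ∈ exposedR M, ℓ v = 0)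
    (hℓ'1 : ∀ (v : R) (m : L), (m, v) ∈ M' → ℓ' v = w m v - maxExpW w M' m)
    (hℓ'2 : ∀ v ∈ exposedR M', ℓ' v = 0) :
    ∀ v : R, ℓ v ≤ ℓ' v := by
  rename_i decL decR
  clear decL decR
  intro v
  have hsub := hM'opt.exposedR_subset
  have hgain := maxExpW_le_gain hu hne hmax
  have hmono := maxExpW_mono hw hsub
  have hkeep : ∀ x, (x, v) ∈ M → (x, v) ∈ M' → ℓ v ≤ ℓ' v := fun x hx hx' => by
    rw [hℓ1 v x hx, hℓ'1 v x hx']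
    linarith [hmono x]
  by_cases hv' : v ∈ exposedR M'
  · rw [hℓ2 v (hsub hv'), hℓ'2 v hv']
  obtain ⟨x, hx⟩ : ∃ x, (x, v) ∈ M' := by
    simpa only [mem_exposedR, not_forall, not_not] using hv'
  rcases hM'opt with ⟨s, hs, rfl⟩ | ⟨s, m, t, hms, ht, hmt, rfl⟩
  · rw [wSum_insert w (hu s)] at hgain
    rcases Finset.mem_insert.1 hx with h | h
    · obtain ⟨rfl, rfl⟩ := Prod.mk.inj h
      rw [hℓ2 v hs, hℓ'1 v x hx]
      linarith [hmono x]
    · exact hkeep x h hx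
  · rw [wSum_augment w hu hms ht] at hgain
    rcases Finset.mem_insert.1 hx with h | h
    · obtain ⟨rfl, rfl⟩ := Prod.mk.inj h
      rw [hℓ1 v m hms, hℓ'1 v x hx]
      linarith [hmono x]
    rcases Finset.mem_insert.1 h with h | h
    · obtain ⟨rfl, rfl⟩ := Prod.mk.inj h
      rw [hℓ2 v ht, hℓ'1 v x hx]
      linarith [hmono x]
    · exact hkeep x (Finset.mem_of_mem_erase h) hx
end
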